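/- Let G be a simple graph with vertex set V and let P = (V_{u,v} | (u,v) ∈ V × V) be a smooth T-partition system on G. If * is a binary operation on V such that for all u, v ∈ V, v ∈ V_{u, u*v}, then (V,*) is a smooth travel groupoid on G. -/

import Mathlib

variable {V : Type*}

/-- The right translation system of a groupoid `(V, op)`:
`rts op u v = {w ∈ V | u * w = v}`. -/
def rts (op : V → V → V) (u v : V) : Set V := {w | op u w = v}

/-- Axiom (t1): `(u * v) * u = u` for all `u, v`. -/
def T1 (op : V → V → V) : Prop := ∀ u v : V, op (op u v) u = u

/-- Axiom (t2): if `(u * v) * v = u` then `u = v`. -/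
def T2 (op : V → V → V) : Prop := ∀ u v : V, op (op u v) v = u → u = v

/-- A travel groupoid: a groupoid satisfying (t1) and (t2). -/
def IsTravelGroupoid (op : V → V → V) : Prop := T1 op ∧ T2 op

/-- Axiom (t3) (simple): if `v * u ≠ u` then `u * (v * u) = u * v`. -/
def T3 (op : V → V → V) : Prop := ∀ u v : V, op v u ≠ u → op u (op v u) = op u v

/-- Axiom (t4) (smooth): if `u * v = u * w` then `u * (v * w) = u * v`. -/
def T4 (op : V → V → V) : Prop := ∀ u v w : V, op u v = op u w → op u (op v w) = op u v

/-- Axiom (t5) (semi-smooth): if `u * v = u * w` then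
`u * (v * w) = u * v` or `u * ((v * w) * w) = u * v`. -/
def T5 (op : V → V → V) : Prop :=
  ∀ u v w : V, op u v = op u w →
    op u (op v w) = op u v ∨ op u (op (op v w) w) = op u v

/-- A travel groupoid `(V, op)` is on the graph `G` if the edges of `G` are exactly
the pairs `{u, v}` with `u ≠ v` and `u * v = v`. -/
def IsOnGraph (op : V → V → V) (G : SimpleGraph V) : Prop :=
  ∀ u v : V, G.Adj u v ↔ u ≠ v ∧ op u v = v

/-- The closed neighborhood `N_G[u]` of a vertex `u` in a graph `G`. -/
def closedNbhd (G : SimpleGraph V) (u : V) : Set V := insert u (G.neighborSet u)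

/-- A T-partition system on a graph `G`: a family `P u v ⊆ V` indexed by pairs of
vertices satisfying (P0) (stated as: the sets `P u v` for `v ∈ N_G[u]` cover `V`
and are pairwise disjoint), (P1a), (P1b), (P1c), and (P2). -/
structure IsTPartitionSystem (G : SimpleGraph V) (P : V → V → Set V) : Prop where
  cover : ∀ u a : V, ∃ v ∈ closedNbhd G u, a ∈ P u v
  pairwise_disjoint : ∀ u : V, ∀ v ∈ closedNbhd G u, ∀ w ∈ closedNbhd G u,
    v ≠ w → P u v ∩ P u w = ∅
  p1a : ∀ u : V, P u u = {u}
  p1b : ∀ u v : V, u ≠ v → (v ∈ P u v ↔ G.Adj u v)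
  p1c : ∀ u v : V, u ≠ v → (P u v = ∅ ↔ ¬ G.Adj u v)
  p2 : ∀ u v : V, u ≠ v → P u v ∩ P v u = ∅

/-- Property (R3) (simple T-partition system). -/
def R3 (P : V → V → Set V) : Prop :=
  ∀ u v x y : V, u ∈ P v x → v ∈ P u y → u ≠ x → v ≠ y → x ∈ P u y ∧ y ∈ P v x

/-- Property (R4) (smooth T-partition system). -/
def R4 (P : V → V → Set V) : Prop :=
  ∀ u v x y z : V, x ∈ P u v → y ∈ P u v → y ∈ P x z → z ∈ P u v

/-- Property (R5) (semi-smooth T-partition system). -/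
def R5 (P : V → V → Set V) : Prop :=
  ∀ u v x y z w : V, x ∈ P u v → y ∈ P u v → y ∈ P x z ∩ P z w →
    z ∈ P u v ∨ w ∈ P u v

/-- In a T-partition system, distinct `u`, `v` with `P u v` nonempty are adjacent. -/
theorem IsTPartitionSystem.adj_of_mem {G : SimpleGraph V} {P : V → V → Set V}
    (hP : IsTPartitionSystem G P) {u v a : V} (huv : u ≠ v) (ha : a ∈ P u v) : G.Adj u v := by
  by_contra h
  rw [(hP.p1c u v huv).2 h] at ha
  exact ha

/-- In a T-partition system, every point of `P u v` determines `v`. -/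
theorem IsTPartitionSystem.eq_of_mem {G : SimpleGraph V} {P : V → V → Set V}
    (hP : IsTPartitionSystem G P) {u v w a : V} (hv : a ∈ P u v) (hw : a ∈ P u w) : v = w := by
  have mem_closedNbhd : ∀ x, a ∈ P u x → x ∈ closedNbhd G u := by
    intro x hx
    by_cases hux : u = x
    · exact Or.inl hux.symm
    · exact Or.inr (hP.adj_of_mem hux hx)
  by_contra hne
  have hmem : a ∈ P u v ∩ P u w := ⟨hv, hw⟩
  rw [hP.pairwise_disjoint u v (mem_closedNbhd v hv) w (mem_closedNbhd w hw) hne] at hmem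
  exact hmem

theorem stmt11 [Nonempty V] (G : SimpleGraph V) (P : V → V → Set V)
    (hP : IsTPartitionSystem G P) (hR4 : R4 P) (op : V → V → V)
    (hop : ∀ u v : V, v ∈ P u (op u v)) :
    (IsTravelGroupoid op ∧ T4 op) ∧ IsOnGraph op G := by
  have op_eq {u v a : V} (ha : a ∈ P u v) : op u a = v := hP.eq_of_mem (hop u a) ha
  have self_mem (u : V) : u ∈ P u u := by simp [hP.p1a]
  refine ⟨⟨⟨fun u v => ?_, fun u v h => ?_⟩, fun u v w h => ?_⟩, fun u v => ⟨fun h => ?_, ?_⟩⟩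
  · by_cases huv : u = op u v
    · rw [← huv]
      exact op_eq (self_mem u)
    · exact op_eq ((hP.p1b _ u (Ne.symm huv)).2 (hP.adj_of_mem huv (hop u v)).symm)
  · have hv := hop u v
    have hv' := hop (op u v) v
    rw [h] at hv'
    by_cases huv : u = op u v
    · rw [← huv, hP.p1a] at hv
      exact hv.symm
    · have hmem : v ∈ P u (op u v) ∩ P (op u v) u := ⟨hv, hv'⟩
      rw [hP.p2 u _ huv] at hmem
      exact hmem.elim
  · exact op_eq (hR4 u (op u v) v w (op v w) (hop u v) (h ▸ hop u w) (hop v w))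
  · exact ⟨h.ne, op_eq ((hP.p1b u v h.ne).2 h)⟩
  · rintro ⟨hne, h⟩
    have hv := hop u v
    rw [h] at hv
    exact (hP.p1b u v hne).1 hv
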